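/- Let k ≥ 1 and let B : EuclideanSpace ℝ (Fin (k+1)) → ((EuclideanSpace ℝ (Fin k)) →ₗ[ℝ] (EuclideanSpace ℝ (Fin (k+1)))) be continuous such that the associated affine planes P_y = {(t, B y t + y) : t ∈ ℝ^k} ⊂ ℝ^k × ℝ^(k+1), y ∈ ℝ^(k+1), are pairwise skew and their union is all of ℝ^k × ℝ^(k+1). Then the following are equivalent: (a) the subspace {0} × ℝ^(k+1) is the unique linear subspace W of ℝ^k × ℝ^(k+1) with finrank ℝ W = k + 1 satisfying W ⊓ (direction of P_y) = ⊥ for every y; (b) for every nonzero t ∈ ℝ^k, the map y ↦ B y t is a surjection of ℝ^(k+1) onto ℝ^(k+1). -/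

import Mathlib

open Metric Module

/-- The affine `k`-plane `P_y = {(t, B y t + y) : t}` associated to a map
`B` into the space of linear maps. -/
noncomputable def plane {q k : ℕ}
    (B : EuclideanSpace ℝ (Fin q) → (EuclideanSpace ℝ (Fin k) →ₗ[ℝ] EuclideanSpace ℝ (Fin q)))
    (y : EuclideanSpace ℝ (Fin q)) :
    AffineSubspace ℝ (EuclideanSpace ℝ (Fin k) × EuclideanSpace ℝ (Fin q)) :=
  AffineSubspace.mk' (0, y) (LinearMap.graph (B y))

theorem exists_weights_det_one_add (E : Type*) [AddCommGroup E] [Module ℝ E]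
    [FiniteDimensional ℝ E] {ε : ℝ} (hε : 0 < ε) :
    ∃ (s : Finset ℕ) (w v : ℕ → ℝ), ∑ i ∈ s, w i = 1 ∧ (∀ i, 0 < v i ∧ v i < ε) ∧
      ∀ A : E →ₗ[ℝ] E, LinearMap.det (1 + A) = ∑ i ∈ s, w i * LinearMap.det (1 + v i • A) := by
  classical
  let v : ℕ → ℝ := fun i => ε / (i + 2)
  let s : Finset ℕ := Finset.range (finrank ℝ E + 1)
  have hv : Function.Injective v := fun i j h => by
    have hi : (0 : ℝ) < i + 2 := by positivity
    have hj : (0 : ℝ) < j + 2 := by positivity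
    have h' : ε / ((i : ℝ) + 2) = ε / (j + 2) := h
    rw [div_eq_div_iff hi.ne' hj.ne', mul_right_inj' hε.ne'] at h'
    exact_mod_cast (add_right_cancel h').symm
  refine ⟨s, fun i => (Lagrange.basis s v i).eval 1, v, ?_, fun i => ⟨by positivity, ?_⟩, ?_⟩
  · rw [← Polynomial.eval_finsetSum, Lagrange.sum_basis hv.injOn ⟨0, by simp [s]⟩,
      Polynomial.eval_one]
  · exact div_lt_self hε (by have : (0 : ℝ) ≤ i := by positivity
                             linarith)
  · intro A
    let b := finBasis ℝ E
    let a := LinearMap.toMatrix b b A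
    let p : Polynomial ℝ := Matrix.det ((Polynomial.X : Polynomial ℝ) • a.map Polynomial.C +
      (1 : Matrix _ _ ℝ).map Polynomial.C)
    have hp : ∀ t : ℝ, p.eval t = LinearMap.det (1 + t • A) := fun t => by
      rw [← LinearMap.det_toMatrix b]
      simp only [p]
      rw [← Polynomial.coe_evalRingHom, RingHom.map_det]
      congr 1
      ext i j
      rw [add_comm (1 : E →ₗ[ℝ] E)]
      simp [a, Matrix.one_apply]
      split_ifs <;> simp [mul_comm]
    have hdeg : p.degree < s.card := by
      refine lt_of_le_of_lt Polynomial.degree_le_natDegree ?_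
      have := Polynomial.natDegree_det_X_add_C_le a 1
      simp only [Fintype.card_fin] at this
      rw [Finset.card_range]
      exact_mod_cast Nat.lt_succ_of_le this
    have h1 := hp 1
    rw [one_smul] at h1
    rw [← h1, Lagrange.eq_interpolate hv.injOn hdeg, Lagrange.interpolate_apply,
      Polynomial.eval_finsetSum]
    refine Finset.sum_congr rfl fun i _ => ?_
    rw [Polynomial.eval_mul, Polynomial.eval_C, hp, mul_comm]

theorem det_one_add_pos {E : Type*} [NormedAddCommGroup E] [NormedSpace ℝ E]
    [FiniteDimensional ℝ E] (A : E →L[ℝ] E) (hA : ‖A‖ < 1) :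
    0 < (1 + A).det := by
  have hne : ∀ s ∈ Set.Icc (0 : ℝ) 1, (1 + s • A).det ≠ 0 := fun s hs h => by
    obtain ⟨x, hx, hx0⟩ := Submodule.exists_mem_ne_zero_of_ne_bot
      (LinearMap.bot_lt_ker_of_det_eq_zero h).ne'
    have h1 : x = -(s • A x) := eq_neg_of_add_eq_zero_left hx
    have h2 : ‖x‖ < ‖x‖ := calc
      ‖x‖ = s * ‖A x‖ := by
        conv_lhs => rw [h1]
        rw [norm_neg, norm_smul, Real.norm_of_nonneg hs.1]
      _ ≤ 1 * ‖A x‖ := by gcongr; exact hs.2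
      _ ≤ 1 * (‖A‖ * ‖x‖) := by gcongr; exact A.le_opNorm x
      _ < ‖x‖ := by
        rw [one_mul]
        exact mul_lt_of_lt_one_left (norm_pos_iff.2 hx0) hA
    exact h2.false
  have hc : ContinuousOn (fun s : ℝ => (1 + s • A).det) (Set.Icc 0 1) :=
    (ContinuousLinearMap.continuous_det.comp (by fun_prop)).continuousOn
  by_contra! h
  obtain ⟨s, hs, h0⟩ := intermediate_value_Icc' zero_le_one hc
    (show (0 : ℝ) ∈ Set.Icc _ _ by
      simpa [ContinuousLinearMap.det] using h)
  exact hne s hs h0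

open MeasureTheory in
theorem not_lipschitz_retraction {E : Type*} [NormedAddCommGroup E] [InnerProductSpace ℝ E]
    [FiniteDimensional ℝ E] {f : E → E} {K : NNReal} {R : ℝ} (hR : 0 < R)
    (hf : LipschitzWith K f) (hd : ∀ x ∈ ball (0 : E) R, DifferentiableAt ℝ f x)
    (hid : ∀ x ∉ ball (0 : E) R, f x = x) : ¬ ∀ x ∈ ball (0 : E) R, ‖f x‖ = R := by
  intro hS
  borelize E
  let μ : Measure E := Measure.addHaar
  let L : NNReal := K + 1
  let h : E → E := fun x => f x - x
  have hL : LipschitzWith L h := hf.sub LipschitzWith.id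
  have hL0 : 0 < L := by positivity
  obtain ⟨s, w, v, hw, hv, hdet⟩ := exists_weights_det_one_add E
    (show (0 : ℝ) < 1 / L by positivity)
  have hh : ∀ x ∈ ball (0 : E) R, HasFDerivAt h (fderiv ℝ h x) x := fun x hx =>
    ((hd x hx).sub differentiableAt_id).hasFDerivAt
  have hbd : ∀ x, ‖fderiv ℝ h x‖ ≤ L := fun x => norm_fderiv_le_of_lipschitz ℝ hL
  have hint : ∀ t : ℝ, IntegrableOn (fun x => (1 + t • fderiv ℝ h x).det) (ball 0 R) μ := by
    intro t
    have hc : Continuous fun A : E →L[ℝ] E => (1 + t • A).det :=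
      ContinuousLinearMap.continuous_det.comp (by fun_prop)
    have : ProperSpace (E →L[ℝ] E) := FiniteDimensional.proper ℝ _
    obtain ⟨C, hC⟩ := (isCompact_closedBall (0 : E →L[ℝ] E) L).exists_bound_of_continuousOn
      hc.continuousOn
    refine Measure.integrableOn_of_bounded (M := C) measure_ball_lt_top.ne ?_ ?_
    · exact (hc.measurable.comp (measurable_fderiv ℝ h)).aestronglyMeasurable
    · exact .of_forall fun x => hC _ (by simpa using hbd x)
  have hsmall : ∀ t : ℝ, 0 < t → t < 1 / L →
      ∫ x in ball 0 R, (1 + t • fderiv ℝ h x).det ∂μ = μ.real (ball 0 R) := by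
    intro t ht0 htL
    have htL' : t * L < 1 := by rwa [lt_div_iff₀ (by positivity)] at htL
    let g : E → E := fun x => x + t • h x
    have hg : ApproximatesLinearOn g ((ContinuousLinearEquiv.refl ℝ E : E ≃L[ℝ] E) : E →L[ℝ] E)
        Set.univ (t.toNNReal * L) := by
      rw [ApproximatesLinearOn]
      intro x _ y _
      have : g x - g y - (x - y) = t • (h x - h y) := by simp only [g, smul_sub]; abel
      simp only [ContinuousLinearEquiv.coe_refl, ContinuousLinearMap.coe_id', id]
      rw [this, norm_smul, Real.norm_of_nonneg ht0.le]
      rw [NNReal.coe_mul, Real.coe_toNNReal t ht0.le, mul_assoc]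
      exact mul_le_mul_of_nonneg_left (hL.norm_sub_le x y) ht0.le
    have hbij : Function.Bijective g := by
      rcases subsingleton_or_nontrivial E with hE | hE
      · exact (hg.toHomeomorph g (.inl hE)).bijective
      · refine (hg.toHomeomorph g (.inr ?_)).bijective
        rw [ContinuousLinearEquiv.refl_symm, ContinuousLinearEquiv.coe_refl,
          ContinuousLinearMap.nnnorm_id, inv_one]
        rwa [← NNReal.coe_lt_coe, NNReal.coe_mul, Real.coe_toNNReal t ht0.le, NNReal.coe_one]
    have himg : g '' ball 0 R = ball 0 R := by
      have : g '' (ball 0 R)ᶜ = (ball 0 R)ᶜ := by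
        refine (Set.image_congr fun x hx => ?_).trans (Set.image_id _)
        simp [g, h, hid x hx]
      rw [Set.image_compl_eq hbij] at this
      exact compl_injective this
    have hgd : ∀ x ∈ ball (0 : E) R,
        HasFDerivWithinAt g (1 + t • fderiv ℝ h x) (ball 0 R) x := fun x hx =>
      ((hasFDerivAt_id x).add ((hh x hx).const_smul t)).hasFDerivWithinAt
    have hcv := integral_image_eq_integral_abs_det_fderiv_smul μ measurableSet_ball hgd
      hbij.injective.injOn (fun _ => (1 : ℝ))
    rw [himg] at hcv
    simp only [smul_eq_mul, mul_one, integral_const, measureReal_restrict_apply_univ] at hcv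
    rw [hcv]
    refine integral_congr_ae (.of_forall fun x => (abs_of_pos ?_).symm)
    refine det_one_add_pos _ ?_
    rw [norm_smul, Real.norm_of_nonneg ht0.le]
    exact (mul_le_mul_of_nonneg_left (hbd x) ht0.le).trans_lt htL'
  have hzero : ∀ x ∈ ball (0 : E) R, (1 + fderiv ℝ h x).det = 0 := by
    intro x hx
    by_contra hne
    have hfd : HasFDerivAt f (1 + fderiv ℝ h x) x := by
      have := (hasFDerivAt_id x).add (hh x hx)
      refine this.congr_of_eventuallyEq (.of_forall fun y => ?_)
      simp [h]
    have hsurj : Function.Surjective (1 + fderiv ℝ h x : E →L[ℝ] E) := by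
      have := (LinearMap.equivOfDetNeZero _ hne).surjective
      exact this
    obtain ⟨u, hu⟩ := hsurj (f x)
    have hconst : (fun y => ‖f y‖ ^ 2) =ᶠ[nhds x] fun _ => R ^ 2 := by
      filter_upwards [isOpen_ball.mem_nhds hx] with y hy
      rw [hS y hy]
    have h1 := hfd.norm_sq.unique ((hasFDerivAt_const (R ^ 2) x).congr_of_eventuallyEq hconst)
    have h2 : (2 : ℕ) • inner ℝ (f x) ((1 + fderiv ℝ h x) u) = 0 := congrArg (fun l => l u) h1
    rw [hu, real_inner_self_eq_norm_sq, hS x hx] at h2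
    have : 0 < (2 : ℕ) • R ^ 2 := by positivity
    exact this.ne' h2
  have key : ∫ x in ball 0 R, (1 + fderiv ℝ h x).det ∂μ = μ.real (ball 0 R) := by
    have : ∀ x, (1 + fderiv ℝ h x).det = ∑ i ∈ s, w i * (1 + v i • fderiv ℝ h x).det :=
      fun x => hdet (fderiv ℝ h x)
    rw [integral_congr_ae (.of_forall this), integral_finsetSum _ fun i _ => (hint (v i)).const_mul (w i)]
    calc ∑ i ∈ s, ∫ x in ball 0 R, w i * (1 + v i • fderiv ℝ h x).det ∂μ
        = ∑ i ∈ s, w i * μ.real (ball 0 R) := Finset.sum_congr rfl fun i _ => by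
          rw [integral_const_mul, hsmall (v i) (hv i).1 (hv i).2]
      _ = μ.real (ball 0 R) := by rw [← Finset.sum_mul, hw, one_mul]
  rw [setIntegral_congr_fun measurableSet_ball hzero] at key
  simp only [integral_zero] at key
  exact (ENNReal.toReal_pos (measure_ball_pos μ (0 : E) hR).ne' measure_ball_lt_top.ne).ne key

/-- A continuous self-map of Euclidean space equal to the identity near infinity has a zero. -/
theorem exists_eq_zero_of_eq_id_outside {E : Type*} [NormedAddCommGroup E] [InnerProductSpace ℝ E]
    [FiniteDimensional ℝ E] {φ : E → E} (hφ : Continuous φ) {r : ℝ} (hr : 0 < r)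
    (hid : ∀ x, r ≤ ‖x‖ → φ x = x) : ∃ x, φ x = 0 := by
  by_contra! hne
  obtain ⟨x₀, -, hx₀⟩ := (isCompact_closedBall (0 : E) r).exists_isMinOn ⟨0, by simp [hr.le]⟩
    hφ.norm.continuousOn
  let ε : ℝ := min r ‖φ x₀‖ / 2
  have hmin : 0 < min r ‖φ x₀‖ := lt_min hr (norm_pos_iff.2 (hne x₀))
  have hε : 0 < ε := half_pos hmin
  have hlow : ∀ x, 2 * ε ≤ ‖φ x‖ := fun x => by
    rw [show 2 * ε = min r ‖φ x₀‖ by simp only [ε]; ring]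
    rcases le_total ‖x‖ r with h | h
    · exact (min_le_right _ _).trans (hx₀ (by simpa using h))
    · rw [hid x h]
      exact (min_le_left _ _).trans h
  obtain ⟨g, hg, hgφ, hsupp⟩ := (hφ.sub continuous_id).exists_contDiff_approx (1 : ℕ∞)
    (ε := fun _ => ε) continuous_const fun _ => hε
  have hg0 : ∀ x, r ≤ ‖x‖ → g x = 0 := fun x hx => by
    by_contra h
    exact hsupp h (by simp [hid x hx])
  have hgc : HasCompactSupport g := HasCompactSupport.intro (isCompact_closedBall (0 : E) r)
    fun x hx => hg0 x (by simpa using (not_le.1 (fun h => hx (by simpa using h))).le)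
  obtain ⟨C, hC⟩ := hg.lipschitzWith_of_hasCompactSupport hgc (by simp)
  let ψ : E → E := fun x => x + g x
  have hψL : LipschitzWith (1 + C) ψ := LipschitzWith.id.add hC
  have hψd : Differentiable ℝ ψ := differentiable_id.add (hg.differentiable (by simp))
  have hψlow : ∀ x, ε ≤ ‖ψ x‖ := fun x => by
    have h1 := hgφ x
    rw [dist_eq_norm] at h1
    have h2 := norm_sub_norm_le (φ x) (ψ x)
    have h3 : φ x - ψ x = -(g x - (φ x - id x)) := by simp only [ψ, id]; abel
    rw [h3, norm_neg] at h2
    have := hlow x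
    simp only [Pi.sub_apply] at h1
    linarith
  obtain ⟨R₀, hR₀⟩ := (isCompact_closedBall (0 : E) r).exists_bound_of_continuousOn
    hψL.continuous.continuousOn
  let R := max r R₀
  have hR : 0 < R := hr.trans_le (le_max_left _ _)
  have hψid : ∀ x, r ≤ ‖x‖ → ψ x = x := fun x hx => by simp [ψ, hg0 x hx]
  have hψup : ∀ x, ‖x‖ ≤ R → ‖ψ x‖ ≤ R := fun x hx => by
    rcases le_total ‖x‖ r with h | h
    · exact (hR₀ x (by simpa using h)).trans (le_max_right _ _)
    · rwa [hψid x h]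
  let a : E → ℝ := fun x => max 1 (R / ‖ψ x‖)
  have ha0 : ∀ x, 0 < ‖ψ x‖ := fun x => hε.trans_le (hψlow x)
  have ha : ∀ x, ‖x‖ < R → a x = R / ‖ψ x‖ := fun x hx =>
    max_eq_right ((one_le_div (ha0 x)).2 (hψup x hx.le))
  have hLip : LipschitzWith ((1 + 2 * (R / ε).toNNReal) * (1 + C)) fun x => a x • ψ x := by
    refine LipschitzWith.of_dist_le_mul fun x y => ?_
    have hRε : 0 < R / ε := div_pos hR hε
    have hax : |a x| ≤ 1 + R / ε := by
      rw [abs_of_pos (zero_lt_one.trans_le (le_max_left _ _))]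
      refine max_le (by linarith) ?_
      have : R / ‖ψ x‖ ≤ R / ε := div_le_div_of_nonneg_left hR.le hε (hψlow x)
      linarith
    have hxy : |a x - a y| * ‖ψ y‖ ≤ R / ε * ‖ψ x - ψ y‖ := by
      have h1 : |a x - a y| ≤ |R / ‖ψ x‖ - R / ‖ψ y‖| := abs_max_sub_max_le_max _ _ _ _ |>.trans
        (by simp)
      have h2 : R / ‖ψ x‖ - R / ‖ψ y‖ = R / ‖ψ x‖ * (‖ψ y‖ - ‖ψ x‖) / ‖ψ y‖ := by
        have := (ha0 x).ne'
        have := (ha0 y).ne'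
        field_simp
      rw [h2, abs_div, abs_norm, le_div_iff₀ (ha0 y), abs_mul,
        abs_of_pos (div_pos hR (ha0 x))] at h1
      refine h1.trans (mul_le_mul (div_le_div_of_nonneg_left hR.le hε (hψlow x)) ?_
        (abs_nonneg _) hRε.le)
      rw [norm_sub_rev]
      exact abs_norm_sub_norm_le _ _
    have hd := hψL.dist_le_mul x y
    rw [dist_eq_norm] at hd ⊢
    have hsplit : a x • ψ x - a y • ψ y = a x • (ψ x - ψ y) + (a x - a y) • ψ y := by module
    calc ‖a x • ψ x - a y • ψ y‖ ≤ |a x| * ‖ψ x - ψ y‖ + |a x - a y| * ‖ψ y‖ := by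
          rw [hsplit]
          refine (norm_add_le _ _).trans_eq ?_
          rw [norm_smul, norm_smul, Real.norm_eq_abs, Real.norm_eq_abs]
      _ ≤ (1 + R / ε) * ‖ψ x - ψ y‖ + R / ε * ‖ψ x - ψ y‖ := by gcongr
      _ = (1 + 2 * (R / ε)) * ‖ψ x - ψ y‖ := by ring
      _ ≤ (1 + 2 * (R / ε)) * (↑(1 + C) * dist x y) := by gcongr
      _ = _ := by
        push_cast
        rw [Real.coe_toNNReal _ hRε.le]
        ring
  refine not_lipschitz_retraction hR hLip (fun x hx => ?_) (fun x hx => ?_) fun x hx => ?_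
  · have : (fun y => a y • ψ y) =ᶠ[nhds x] fun y => (R / ‖ψ y‖) • ψ y := by
      filter_upwards [isOpen_ball.mem_nhds hx] with y hy
      rw [ha y (by simpa using hy)]
    refine DifferentiableAt.congr_of_eventuallyEq ?_ this
    have h0 : ψ x ≠ 0 := norm_pos_iff.1 (ha0 x)
    have hn : DifferentiableAt ℝ (fun y => ‖ψ y‖) x := (hψd x).norm ℝ h0
    simp_rw [div_eq_mul_inv]
    exact ((hn.fun_inv (ha0 x).ne').const_mul R).smul (hψd x)
  · have hx' : R ≤ ‖x‖ := by simpa using hx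
    have h1 : ψ x = x := hψid x ((le_max_left _ _).trans hx')
    have h2 : a x = 1 := by
      simp only [a, h1]
      exact max_eq_left ((div_le_one (hR.trans_le hx')).2 hx')
    simp [h1, h2]
  · rw [ha x (by simpa using hx), norm_smul, Real.norm_of_nonneg (div_pos hR (ha0 x)).le,
      div_mul_cancel₀ _ (ha0 x).ne']

theorem surjective_of_eq_id_outside {E : Type*} [NormedAddCommGroup E] [InnerProductSpace ℝ E]
    [FiniteDimensional ℝ E] {φ : E → E} (hφ : Continuous φ) {r : ℝ}
    (hid : ∀ x, r ≤ ‖x‖ → φ x = x) : Function.Surjective φ := by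
  intro p
  obtain ⟨x, hx⟩ := exists_eq_zero_of_eq_id_outside (φ := fun x => φ (x + p) - p)
    (r := |r| + ‖p‖ + 1) (by fun_prop) (by positivity) fun x hx => by
      have h1 := norm_sub_norm_le x (-p)
      rw [norm_neg, sub_neg_eq_add] at h1
      rw [hid (x + p) (by linarith [le_abs_self r]), add_sub_cancel_right]
  exact ⟨x + p, sub_eq_zero.1 hx⟩

open Filter Topology

theorem exists_limit_submodule_of_inner {E : Type*} [NormedAddCommGroup E] [InnerProductSpace ℝ E]
    [FiniteDimensional ℝ E] {d : ℕ} (S : ℕ → Submodule ℝ E) (hS : ∀ n, finrank ℝ (S n) = d) :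
    ∃ (W : Submodule ℝ E) (θ : ℕ → ℕ), finrank ℝ W = d ∧ StrictMono θ ∧
      (∀ x ∈ W, ∃ z : ℕ → E, (∀ n, z n ∈ S (θ n)) ∧ Tendsto z atTop (𝓝 x)) ∧
      ∀ (z : ℕ → E) (x : E), (∀ n, z n ∈ S (θ n)) → Tendsto z atTop (𝓝 x) → x ∈ W := by
  let o : ∀ n, OrthonormalBasis (Fin d) ℝ (S n) := fun n =>
    (stdOrthonormalBasis ℝ (S n)).reindex (finCongr (hS n))
  let e : ℕ → Fin d → E := fun n i => o n i
  have he : ∀ n, Orthonormal ℝ (e n) := fun n =>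
    (o n).orthonormal.comp_linearIsometry (S n).subtypeₗᵢ
  obtain ⟨b, -, θ, hθ, hb⟩ := (isCompact_closedBall (0 : Fin d → E) 1).tendsto_subseq
    (x := e) fun n => by
      rw [mem_closedBall_zero_iff]
      exact (pi_norm_le_iff_of_nonneg zero_le_one).2 fun i => ((he n).1 i).le
  have hbi : ∀ i, Tendsto (fun n => e (θ n) i) atTop (𝓝 (b i)) := tendsto_pi_nhds.1 hb
  have hbo : Orthonormal ℝ b := by
    rw [orthonormal_iff_ite]
    intro i j
    refine tendsto_nhds_unique ((hbi i).inner (hbi j)) ?_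
    simp_rw [fun n => orthonormal_iff_ite.1 (he (θ n)) i j]
    exact tendsto_const_nhds
  refine ⟨Submodule.span ℝ (Set.range b), θ, ?_, hθ, fun x hx => ?_, fun z x hz hx => ?_⟩
  · rw [finrank_span_eq_card hbo.linearIndependent, Fintype.card_fin]
  · obtain ⟨c, rfl⟩ := (Submodule.mem_span_range_iff_exists_fun ℝ).1 hx
    exact ⟨fun n => ∑ i, c i • e (θ n) i,
      fun n => Submodule.sum_mem _ fun i _ => Submodule.smul_mem _ _ (o (θ n) i).2,
      tendsto_finsetSum _ fun i _ => (hbi i).const_smul (c i)⟩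
  · have hsum : ∀ n, z n = ∑ i, inner ℝ (e (θ n) i) (z n) • e (θ n) i := fun n => by
      have := congrArg Subtype.val ((o (θ n)).sum_repr' ⟨z n, hz n⟩)
      simpa [e] using this.symm
    have hlim : Tendsto z atTop (𝓝 (∑ i, inner ℝ (b i) x • b i)) := by
      rw [funext hsum]
      exact tendsto_finsetSum _ fun i _ => ((hbi i).inner hx).smul (hbi i)
    rw [tendsto_nhds_unique hx hlim]
    exact Submodule.sum_mem _ fun i _ =>
      Submodule.smul_mem _ _ (Submodule.subset_span ⟨i, rfl⟩)

/-- Sequential compactness of the Grassmannian of `d`-dimensional subspaces. -/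
theorem exists_limit_submodule {E : Type*} [NormedAddCommGroup E] [NormedSpace ℝ E]
    [FiniteDimensional ℝ E] {d : ℕ} (S : ℕ → Submodule ℝ E) (hS : ∀ n, finrank ℝ (S n) = d) :
    ∃ (W : Submodule ℝ E) (θ : ℕ → ℕ), finrank ℝ W = d ∧ StrictMono θ ∧
      (∀ x ∈ W, ∃ z : ℕ → E, (∀ n, z n ∈ S (θ n)) ∧ Tendsto z atTop (𝓝 x)) ∧
      ∀ (z : ℕ → E) (x : E), (∀ n, z n ∈ S (θ n)) → Tendsto z atTop (𝓝 x) → x ∈ W := by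
  let e := toEuclidean (E := E)
  let l := e.toLinearEquiv
  obtain ⟨W, θ, hW, hθ, h1, h2⟩ := exists_limit_submodule_of_inner
    (fun n => (S n).map l.toLinearMap) fun n => by
      rw [LinearEquiv.finrank_map_eq, hS]
  refine ⟨W.map l.symm.toLinearMap, θ, ?_, hθ, ?_, fun z x hz hx => ?_⟩
  · rw [LinearEquiv.finrank_map_eq, hW]
  · rintro _ ⟨x, hx, rfl⟩
    obtain ⟨z, hz, hzx⟩ := h1 x hx
    refine ⟨fun n => e.symm (z n), fun n => ?_, (e.symm.continuous.tendsto x).comp hzx⟩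
    obtain ⟨y, hy, hyz⟩ := hz n
    have : e.symm (z n) = y := by
      rw [← hyz]
      exact e.symm_apply_apply y
    change e.symm (z n) ∈ S (θ n)
    rwa [this]
  · exact ⟨e x, h2 (fun n => e (z n)) (e x) (fun n => ⟨z n, hz n, rfl⟩)
      ((e.continuous.tendsto x).comp hx), e.symm_apply_apply x⟩

section Pencil

variable {T V : Type*} [NormedAddCommGroup T] [NormedSpace ℝ T] [NormedAddCommGroup V]

/-- The homogenization `(r, t) ↦ r • y + A y t` of the affine map `t ↦ A y t + y`. -/
def homogenization [NormedSpace ℝ V] (A : V → T →L[ℝ] V) (y : V) : ℝ × T →ₗ[ℝ] V :=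
  (LinearMap.fst ℝ ℝ T).smulRight y + (A y).toLinearMap ∘ₗ LinearMap.snd ℝ ℝ T

@[simp]
theorem homogenization_apply [NormedSpace ℝ V] (A : V → T →L[ℝ] V) (y : V) (u : ℝ × T) :
    homogenization A y u = u.1 • y + A y u.2 := rfl

variable [InnerProductSpace ℝ V]

theorem continuous_homogenization {A : V → T →L[ℝ] V} (hA : Continuous A) :
    Continuous fun p : V × (ℝ × T) => homogenization A p.1 p.2 := by
  simp only [homogenization_apply]
  fun_prop

variable [FiniteDimensional ℝ V]

theorem eventually_exists_homogenization_eq {A : V → T →L[ℝ] V} (hA : Continuous A)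
    (hinj : ∀ u ≠ 0, Function.Injective fun y => homogenization A y u) (y₀ : V) {u₀ : ℝ × T}
    (hu₀ : u₀ ≠ 0) :
    ∀ᶠ p : (ℝ × T) × V in 𝓝 (u₀, homogenization A y₀ u₀),
      ∃ y, ‖y - y₀‖ ≤ 1 ∧ homogenization A y p.1 = p.2 := by
  have hc := continuous_homogenization hA
  obtain ⟨σ, hσ, hσu⟩ : ∃ σ : ℝ, σ * σ = 1 ∧ 0 ≤ σ * u₀.1 := by
    rcases le_total 0 u₀.1 with h | h
    · exact ⟨1, by norm_num, by simpa using h⟩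
    · exact ⟨-1, by norm_num, by simpa using h⟩
  let c : ℝ → ℝ × T → ℝ × T := fun τ u => (1 - τ) • u + τ • (σ, 0)
  have hcc : Continuous fun p : ℝ × (ℝ × T) => c p.1 p.2 := by fun_prop
  have hc0 : ∀ τ ∈ Set.Icc (0 : ℝ) 1, c τ u₀ ≠ 0 := by
    intro τ hτ h
    have h1 : (1 - τ) * u₀.1 + τ * σ = 0 := by simpa [c] using congrArg Prod.fst h
    have h2 : (1 - τ) • u₀.2 = 0 := by simpa [c] using congrArg Prod.snd h
    have h3 : (1 - τ) * (σ * u₀.1) + τ = 0 := by linear_combination σ * h1 - τ * hσ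
    have h4 : τ = 0 := by
      have := mul_nonneg (sub_nonneg.2 hτ.2) hσu
      linarith [hτ.1]
    subst h4
    exact hu₀ (Prod.ext (by simpa using h1) (by simpa using h2))
  let D : V → ℝ × T → V := fun y u => homogenization A (y₀ + y) u - homogenization A y₀ u
  have hDc : Continuous fun p : V × (ℝ × T) => D p.1 p.2 :=
    (hc.comp (by fun_prop : Continuous fun p : V × (ℝ × T) => (y₀ + p.1, p.2))).sub
      (hc.comp (by fun_prop : Continuous fun p : V × (ℝ × T) => (y₀, p.2)))
  have hDσ : ∀ y, D y (σ, 0) = σ • y := fun y => by simp [D]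
  let Q : Set (ℝ × V) := Set.Icc 0 1 ×ˢ (closedBall 0 1 \ ball 0 (1 / 2))
  have hQ : IsCompact Q := isCompact_Icc.prod ((isCompact_closedBall _ _).diff isOpen_ball)
  have hz : Continuous fun p : (ℝ × T) × V => p.2 - homogenization A y₀ p.1 :=
    continuous_snd.sub (hc.comp (by fun_prop : Continuous fun p : (ℝ × T) × V => (y₀, p.1)))
  have hev : ∀ᶠ p : (ℝ × T) × V in 𝓝 (u₀, homogenization A y₀ u₀), ∀ q ∈ Q,
      D q.2 (c q.1 p.1) ≠ p.2 - homogenization A y₀ p.1 := by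
    refine hQ.eventually_forall_of_forall_eventually fun q hq => ?_
    have hl : Continuous fun r : ((ℝ × T) × V) × (ℝ × V) => D r.2.2 (c r.2.1 r.1.1) :=
      hDc.comp ((continuous_snd.comp continuous_snd).prodMk
        (hcc.comp ((continuous_fst.comp continuous_snd).prodMk
          (continuous_fst.comp continuous_fst))))
    have hr : Continuous fun r : ((ℝ × T) × V) × (ℝ × V) =>
        r.1.2 - homogenization A y₀ r.1.1 := hz.comp continuous_fst
    refine (isOpen_ne_fun hl hr).mem_nhds fun h => ?_
    simp only [sub_self] at h
    have := hinj _ (hc0 q.1 hq.1) (sub_eq_zero.1 h)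
    have h0 : q.2 = 0 := by simpa using this
    apply hq.2.2
    rw [h0]
    simp
  have hsmall : ∀ᶠ p : (ℝ × T) × V in 𝓝 (u₀, homogenization A y₀ u₀),
      ‖p.2 - homogenization A y₀ p.1‖ < 1 :=
    hz.norm.continuousAt.eventually_lt continuousAt_const (by simp)
  filter_upwards [hev, hsmall] with p hp hp1
  let τ : V → ℝ := fun y => max 0 (min 1 (2 * ‖y‖ - 1))
  have hφ : Continuous fun y => σ • D y (c (τ y) p.1) := by
    have hτ : Continuous fun y => (τ y, p.1) := by fun_prop
    have hD : Continuous fun y => D y (c (τ y) p.1) :=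
      hDc.comp (continuous_id.prodMk (hcc.comp hτ))
    exact hD.const_smul σ
  obtain ⟨y, hy⟩ := surjective_of_eq_id_outside hφ (r := 1) (fun y hy => by
    have : τ y = 1 := by
      simp only [τ]
      rw [min_eq_left (by linarith), max_eq_right zero_le_one]
    simp only [this, c, sub_self, zero_smul, one_smul, zero_add, hDσ, smul_smul, hσ])
    (σ • (p.2 - homogenization A y₀ p.1))
  have hσ0 : σ ≠ 0 := fun h => by simp [h] at hσ
  have hy' : D y (c (τ y) p.1) = p.2 - homogenization A y₀ p.1 := smul_right_injective V hσ0 hy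
  have hy1 : ‖y‖ < 1 := by
    by_contra! h
    have h1 : τ y = 1 := by
      simp only [τ]
      rw [min_eq_left (by linarith), max_eq_right zero_le_one]
    rw [h1] at hy'
    simp only [c, sub_self, zero_smul, one_smul, zero_add, hDσ] at hy'
    have hσn : ‖σ‖ = 1 := by
      rw [Real.norm_eq_abs]
      rcases mul_self_eq_one_iff.1 hσ with rfl | rfl <;> simp
    rw [← hy', norm_smul, hσn, one_mul] at hp1
    exact hp1.not_ge h
  have hy2 : ‖y‖ < 1 / 2 := by
    by_contra! h
    exact hp (τ y, y) ⟨⟨le_max_left _ _, max_le zero_le_one (min_le_left _ _)⟩,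
      by simpa using hy1.le, by simpa using h⟩ hy'
  have hτ : τ y = 0 := max_eq_left ((min_le_right _ _).trans (by linarith))
  refine ⟨y₀ + y, by simpa using hy1.le, ?_⟩
  rw [hτ] at hy'
  simp only [c, sub_zero, one_smul, zero_smul, add_zero, D] at hy'
  exact sub_left_injective hy'

theorem exists_transverse_submodule [FiniteDimensional ℝ T] {A : V → T →L[ℝ] V}
    (hA : Continuous A)
    (hinj : ∀ u ≠ 0, Function.Injective fun y => homogenization A y u)
    (hsurj : ∀ u : ℝ × T, u.1 ≠ 0 → Function.Surjective fun y => homogenization A y u)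
    {t₀ : T} {w₀ : V} (hw₀ : ∀ y, A y t₀ ≠ w₀) :
    ∃ W : Submodule ℝ (T × V), finrank ℝ W = finrank ℝ T + 1 ∧ (t₀, w₀) ∈ W ∧
      ∀ y, W ⊓ (A y).toLinearMap.graph = ⊥ := by
  let s : ℕ → ℝ := fun n => 1 / ((n : ℝ) + 1)
  have hs : Tendsto s atTop (𝓝 0) := tendsto_one_div_add_atTop_nhds_zero_nat
  choose y hy using fun n => hsurj (s n, t₀) (Nat.one_div_pos_of_nat).ne' w₀
  have hesc : ∀ y₀ : V, ∀ᶠ n in atTop, ¬ ‖y n - y₀‖ ≤ 1 := by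
    intro y₀
    by_contra h
    have h' : ∃ᶠ n in atTop, y n ∈ closedBall y₀ 1 := by
      simpa [Filter.Frequently, dist_eq_norm] using h
    obtain ⟨a, -, η, hη, ha⟩ := (isCompact_closedBall y₀ 1).tendsto_subseq' h'
    have h1 := ((continuous_homogenization hA).tendsto (a, (0, t₀))).comp
      (ha.prodMk_nhds ((hs.comp hη.tendsto_atTop).prodMk_nhds tendsto_const_nhds))
    have h2 := tendsto_nhds_unique h1 (tendsto_const_nhds.congr fun n => (hy (η n)).symm)
    exact hw₀ a (by simpa using h2)
  obtain ⟨W, θ, hWd, hθ, hW1, hW2⟩ := exists_limit_submodule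
    (fun n => (homogenization A (y n)).graph) (d := finrank ℝ T + 1) fun n => by
      rw [LinearMap.graph_eq_range_prod, LinearMap.finrank_range_of_inj
        (fun a b h => congrArg Prod.fst h), finrank_prod, finrank_self, add_comm]
  have hdisj : ∀ x ∈ W, x.1 ≠ 0 → ∀ y₀, homogenization A y₀ x.1 ≠ x.2 := by
    intro x hx hx1 y₀ h
    obtain ⟨z, hz, hzx⟩ := hW1 x hx
    have h1 := eventually_exists_homogenization_eq hA hinj y₀ hx1
    rw [h] at h1
    obtain ⟨n, ⟨y', hy'1, hy'2⟩, hn1, hn2⟩ := ((hzx.eventually h1).and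
      ((hθ.tendsto_atTop.eventually (hesc y₀)).and
        ((continuous_fst.tendsto x).comp hzx |>.eventually_ne hx1))).exists
    have h3 : (z n).2 = homogenization A (y (θ n)) (z n).1 := (LinearMap.mem_graph_iff _ _).1 (hz n)
    rw [hinj _ hn2 (hy'2.trans h3)] at hy'1
    exact hn1 hy'1
  let ι : T × V →ₗ[ℝ] (ℝ × T) × V := (LinearMap.inr ℝ ℝ T).prodMap LinearMap.id
  have hι : Function.Injective ι := fun a b h => by
    simpa [ι, Prod.ext_iff] using h
  have hr : W ≤ LinearMap.range ι := by
    rintro ⟨⟨r, t⟩, v⟩ hx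
    have hr0 : r = 0 := by
      by_contra hr0
      obtain ⟨y₀, hy₀⟩ := hsurj (r, t) hr0 v
      exact hdisj _ hx (fun h => hr0 (congrArg Prod.fst h)) y₀ hy₀
    subst hr0
    exact ⟨(t, v), rfl⟩
  refine ⟨W.comap ι, ?_, ?_, fun y₀ => ?_⟩
  · rw [(Submodule.equivMapOfInjective ι hι _).finrank_eq, Submodule.map_comap_eq_of_le hr, hWd]
  · refine hW2 (fun n => ((s (θ n), t₀), w₀)) _ (fun n => ?_) ?_
    · exact (LinearMap.mem_graph_iff _ _).2 (hy (θ n)).symm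
    · exact ((hs.comp hθ.tendsto_atTop).prodMk_nhds tendsto_const_nhds).prodMk_nhds
        tendsto_const_nhds
  · rw [Submodule.eq_bot_iff]
    rintro ⟨t, v⟩ ⟨h1, h2⟩
    have hv : v = A y₀ t := (LinearMap.mem_graph_iff _ _).1 h2
    by_cases ht : t = 0
    · subst ht
      simp [hv]
    · exact absurd (by simp [ι, hv]) (hdisj _ h1 (by simpa [ι] using ht) y₀)

end Pencil

theorem direction_plane {q k : ℕ}
    (B : EuclideanSpace ℝ (Fin q) → (EuclideanSpace ℝ (Fin k) →ₗ[ℝ] EuclideanSpace ℝ (Fin q)))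
    (y : EuclideanSpace ℝ (Fin q)) : (plane B y).direction = (B y).graph :=
  AffineSubspace.direction_mk' _ _

theorem mem_plane_iff {q k : ℕ}
    {B : EuclideanSpace ℝ (Fin q) → (EuclideanSpace ℝ (Fin k) →ₗ[ℝ] EuclideanSpace ℝ (Fin q))}
    {y : EuclideanSpace ℝ (Fin q)} {p : EuclideanSpace ℝ (Fin k) × EuclideanSpace ℝ (Fin q)} :
    p ∈ plane B y ↔ p.2 = B y p.1 + y := by
  simp [plane, AffineSubspace.mem_mk', LinearMap.mem_graph_iff, sub_eq_iff_eq_add]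

theorem unique_transverse_iff_surjective (k : ℕ) (hk : 1 ≤ k)
    (B : EuclideanSpace ℝ (Fin (k + 1)) →
      (EuclideanSpace ℝ (Fin k) →ₗ[ℝ] EuclideanSpace ℝ (Fin (k + 1))))
    (hB : Continuous fun y => LinearMap.toContinuousLinearMap (B y))
    (hskew : ∀ x y : EuclideanSpace ℝ (Fin (k + 1)), x ≠ y →
      Disjoint (plane B x : Set (EuclideanSpace ℝ (Fin k) × EuclideanSpace ℝ (Fin (k + 1))))
        (plane B y : Set (EuclideanSpace ℝ (Fin k) × EuclideanSpace ℝ (Fin (k + 1)))) ∧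
      (plane B x).direction ⊓ (plane B y).direction = ⊥)
    (hcover : ∀ p : EuclideanSpace ℝ (Fin k) × EuclideanSpace ℝ (Fin (k + 1)),
      ∃ y : EuclideanSpace ℝ (Fin (k + 1)), p ∈ plane B y) :
    (∀ W : Submodule ℝ (EuclideanSpace ℝ (Fin k) × EuclideanSpace ℝ (Fin (k + 1))),
        (finrank ℝ W = k + 1 ∧ ∀ y, W ⊓ (plane B y).direction = ⊥) ↔
          W = Submodule.prod (⊥ : Submodule ℝ (EuclideanSpace ℝ (Fin k)))
            (⊤ : Submodule ℝ (EuclideanSpace ℝ (Fin (k + 1))))) ↔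
    (∀ t : EuclideanSpace ℝ (Fin k), t ≠ 0 →
      Function.Surjective fun y : EuclideanSpace ℝ (Fin (k + 1)) => B y t) := by
  let A := fun y => LinearMap.toContinuousLinearMap (B y)
  have hgraph : ∀ x y, x ≠ y → ∀ t, B x t = B y t → t = 0 := fun x y hxy t h => by
    have h1 : (t, B x t) ∈ (plane B x).direction ⊓ (plane B y).direction := by
      rw [direction_plane, direction_plane]
      exact ⟨rfl, h⟩
    rw [(hskew x y hxy).2, Submodule.mem_bot] at h1
    exact congrArg Prod.fst h1
  have hscale : ∀ (r : ℝ) (hr : r ≠ 0) (t : EuclideanSpace ℝ (Fin k)) y v,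
      (r⁻¹ • t, r⁻¹ • v) ∈ plane B y ↔ v = homogenization A y (r, t) := fun r hr t y v => by
    have : homogenization A y (r, t) = r • (B y (r⁻¹ • t) + y) := by
      rw [map_smul, smul_add, smul_inv_smul₀ hr]
      exact add_comm _ _
    rw [mem_plane_iff, this, inv_smul_eq_iff₀ hr]
  have hinj : ∀ u ≠ 0, Function.Injective fun y => homogenization A y u := by
    rintro ⟨r, t⟩ hu x y hxy
    by_contra hne
    rcases eq_or_ne r 0 with rfl | hr
    · have ht := hgraph x y hne t (by simpa [A] using hxy)
      exact hu (by simp [ht])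
    · exact Set.disjoint_left.1 (hskew x y hne).1 ((hscale r hr t x _).2 rfl)
        ((hscale r hr t y _).2 hxy)
  have hsurj : ∀ u : ℝ × EuclideanSpace ℝ (Fin k), u.1 ≠ 0 →
      Function.Surjective fun y => homogenization A y u := by
    rintro ⟨r, t⟩ hr v
    obtain ⟨y, hy⟩ := hcover (r⁻¹ • t, r⁻¹ • v)
    exact ⟨y, ((hscale r hr t y v).1 hy).symm⟩
  simp only [direction_plane]
  constructor
  · intro ha t ht w
    by_contra! hw
    obtain ⟨W, hWd, hWm, hWA⟩ := exists_transverse_submodule (A := A) hB hinj hsurj hw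
    rw [(ha W).1 ⟨by simpa using hWd, hWA⟩] at hWm
    exact ht (by simpa using hWm.1)
  · intro hb W
    have hfin : finrank ℝ (Submodule.prod (⊥ : Submodule ℝ (EuclideanSpace ℝ (Fin k)))
        (⊤ : Submodule ℝ (EuclideanSpace ℝ (Fin (k + 1))))) = k + 1 := by
      have : Submodule.prod (⊥ : Submodule ℝ (EuclideanSpace ℝ (Fin k)))
          (⊤ : Submodule ℝ (EuclideanSpace ℝ (Fin (k + 1)))) = Submodule.snd ℝ _ _ := by
        ext
        simp [Submodule.snd]
      rw [this, (Submodule.sndEquiv ℝ _ _).finrank_eq, finrank_euclideanSpace_fin]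
    refine ⟨fun ⟨hWd, hW⟩ => ?_, ?_⟩
    · refine Submodule.eq_of_le_of_finrank_eq ?_ (hWd.trans hfin.symm)
      rintro ⟨t, w⟩ htw
      refine ⟨?_, trivial⟩
      by_contra ht
      obtain ⟨y, hy⟩ := hb t ht w
      have h1 : (t, w) ∈ W ⊓ (B y).graph := ⟨htw, hy.symm⟩
      rw [hW y, Submodule.mem_bot] at h1
      exact ht (congrArg Prod.fst h1)
    · rintro rfl
      refine ⟨hfin, fun y => ?_⟩
      rw [Submodule.eq_bot_iff]
      rintro ⟨t, w⟩ ⟨⟨ht, -⟩, hw⟩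
      have ht' : t = 0 := ht
      have hw' : w = B y t := hw
      rw [hw', ht', map_zero]
      rfl
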